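/- arXiv:1503.04064 — 2 statements merged into one kernel-verified Lean document; each statement's English description precedes it below -/
import Mathlib

section
/- There exists a constant c > 0, independent of n, such that for every n ≥ 2 and every ε with |ε| ≤ 1/c, the discrete Gaussian bridge B_n satisfies | P( B_n(j) ≤ 0 for all j ∈ {1,…,n−1} ) − P( B_n(j) ≤ ε for all j ∈ {1,…,n−1} ) | ≤ c |ε| / n. -/
open MeasureTheory ProbabilityTheory Real Filter Finset Topology

noncomputable section

/-- The canonical measure for `n` i.i.d. standard Gaussian increments. -/
def gaussPi (n : ℕ) : Measure (Fin n → ℝ) := Measure.pi fun _ => gaussianReal 0 1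

instance (n : ℕ) : IsProbabilityMeasure (gaussPi n) := by
  unfold gaussPi; infer_instance

/-- The discrete bridge built from the increments `x`:
`B_n(j) = Σ_{i<j} x_i − (j/n) Σ_{i<n} x_i`. -/
def bridge (n : ℕ) (x : Fin n → ℝ) (j : ℕ) : ℝ :=
  (∑ i ∈ Finset.univ.filter fun i : Fin n => (i : ℕ) < j, x i)
    - ((j : ℝ) / n) * ∑ i, x i

end

/-- Partial sums of the `n`-periodic extension of `x`. -/
def psum (n : ℕ) [NeZero n] (j : ℕ) (x : Fin n → ℝ) : ℝ :=
  ∑ i ∈ Finset.range j, x (Fin.ofNat n i)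

/-- The `m` consecutive coordinates of the `n`-periodic extension of `x` starting at `s`. -/
def window (n : ℕ) [NeZero n] (m s : ℕ) (x : Fin n → ℝ) : Fin m → ℝ :=
  fun i => x (Fin.ofNat n (s + i))

/-- The bridge of length `m` over the window of `x` starting at `s`, evaluated at `j`. -/
noncomputable def windowBridge (n : ℕ) [NeZero n] (s m j : ℕ) (x : Fin n → ℝ) : ℝ :=
  psum n (s + j) x - psum n s x - (j / m : ℝ) * (psum n (s + m) x - psum n s x)

lemma measurePreserving_window (n : ℕ) [NeZero n] {m : ℕ} (s : ℕ) (hm : m ≤ n) :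
    MeasurePreserving (window n m s) (gaussPi n) (gaussPi m) := by
  refine ⟨measurable_pi_lambda _ fun i => measurable_pi_apply _, ?_⟩
  have hinj : Function.Injective fun i : Fin m => Fin.ofNat n (s + i) := by
    intro i j hij
    have h : s + i ≡ s + j [MOD n] := by simpa [Fin.ext_iff, Nat.ModEq] using hij
    have h' := Nat.ModEq.add_left_cancel' s h
    exact Fin.ext (Nat.ModEq.eq_of_lt_of_lt h' (i.2.trans_le hm) (j.2.trans_le hm))
  have h := Measure.map_infinitePi_infinitePi_of_inj
    (P := fun _ : Fin n => gaussianReal 0 1) hinj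
  rwa [Measure.infinitePi_eq_pi, Measure.infinitePi_eq_pi] at h

lemma sum_filter_lt_eq_sum_range {m : ℕ} {j : ℕ} (hj : j ≤ m) (f : ℕ → ℝ) :
    ∑ i ∈ Finset.univ.filter (fun i : Fin m => (i : ℕ) < j), f i = ∑ i ∈ Finset.range j, f i := by
  rw [Finset.sum_filter, Fin.sum_univ_eq_sum_range (fun i => if i < j then f i else 0),
    ← Finset.sum_filter]
  congr 1
  ext i
  simp only [Finset.mem_filter, Finset.mem_range]
  omega

lemma bridge_window (n : ℕ) [NeZero n] {m j : ℕ} (s : ℕ) (hj : j ≤ m) (x : Fin n → ℝ) :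
    bridge m (window n m s x) j = windowBridge n s m j x := by
  have h : ∀ j : ℕ, psum n (s + j) x - psum n s x
      = ∑ i ∈ Finset.range j, x (Fin.ofNat n (s + i)) := fun j => by
    rw [psum, psum, Finset.sum_range_add]; ring
  rw [bridge, windowBridge, h, h]
  unfold window
  rw [sum_filter_lt_eq_sum_range hj fun i => x (Fin.ofNat n (s + i)),
    Fin.sum_univ_eq_sum_range fun i => x (Fin.ofNat n (s + i))]

lemma bridge_eq_windowBridge (n : ℕ) [NeZero n] {j : ℕ} (hj : j ≤ n) (x : Fin n → ℝ) :
    bridge n x j = windowBridge n 0 n j x := by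
  rw [← bridge_window n 0 hj]
  congr 1
  ext i
  simp [window]

lemma psum_add_period (n : ℕ) [NeZero n] (s : ℕ) (x : Fin n → ℝ) :
    psum n (s + n) x = psum n s x + psum n n x := by
  have h (i : ℕ) : Fin.ofNat n (n + i) = Fin.ofNat n i := by simp [Fin.ext_iff]
  rw [add_comm s n, psum, Finset.sum_range_add, add_comm]
  simp only [h, psum]

lemma hasGaussianLaw_gaussPi (n : ℕ) : HasGaussianLaw (fun x : Fin n → ℝ => x) (gaussPi n) := by
  refine iIndepFun.hasGaussianLaw (X := fun i (x : Fin n → ℝ) => x i) (fun i => ?_) ?_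
  · refine ⟨?_⟩
    have := (measurePreserving_eval (fun _ : Fin n => gaussianReal 0 1) i).map_eq
    unfold gaussPi
    change IsGaussian ((Measure.pi fun _ : Fin n => gaussianReal 0 1).map (Function.eval i))
    rw [this]
    infer_instance
  · exact iIndepFun_pi (X := fun _ : Fin n => (id : ℝ → ℝ)) (fun _ => aemeasurable_id)

lemma memLp_eval_gaussPi (n : ℕ) (i : Fin n) : MemLp (fun x => x i) 2 (gaussPi n) :=
  ((hasGaussianLaw_gaussPi n).eval i).memLp_two

lemma covariance_eval_gaussPi (n : ℕ) (i j : Fin n) :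
    cov[fun x => x i, fun x => x j; gaussPi n] = if i = j then 1 else 0 := by
  split_ifs with h
  · subst h
    have hm : AEMeasurable (fun x : Fin n → ℝ => x i) (gaussPi n) :=
      (measurable_pi_apply i).aemeasurable
    have hv := variance_fun_id_gaussianReal (μ := 0) (v := 1)
    rw [← (measurePreserving_eval (fun _ : Fin n => gaussianReal 0 1) i).map_eq] at hv
    rw [covariance_self hm]
    exact (variance_map (X := fun y => y) (by fun_prop) hm).symm.trans hv
  · exact ((iIndepFun_pi (X := fun _ : Fin n => (id : ℝ → ℝ))
      (fun _ => aemeasurable_id)).indepFun h).covariance_eq_zero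
      (memLp_eval_gaussPi n i) (memLp_eval_gaussPi n j)

lemma memLp_psum (n : ℕ) [NeZero n] (s : ℕ) : MemLp (psum n s) 2 (gaussPi n) :=
  memLp_finsetSum _ fun _ _ => memLp_eval_gaussPi n _

lemma covariance_psum (n : ℕ) [NeZero n] {s t : ℕ} (hs : s ≤ n) (ht : t ≤ n) :
    cov[psum n s, psum n t; gaussPi n] = min (s : ℝ) t := by
  unfold psum
  rw [covariance_fun_sum_fun_sum' (fun _ _ => memLp_eval_gaussPi n _)
    (fun _ _ => memLp_eval_gaussPi n _)]
  have h : ∀ i ∈ Finset.range s, ∀ j ∈ Finset.range t,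
      cov[fun x => x (Fin.ofNat n i), fun x => x (Fin.ofNat n j); gaussPi n]
        = if i = j then 1 else 0 := by
    intro i hi j hj
    rw [covariance_eval_gaussPi]
    congr 1
    simp only [Finset.mem_range] at hi hj
    simp [Fin.ext_iff, Nat.mod_eq_of_lt (hi.trans_le hs), Nat.mod_eq_of_lt (hj.trans_le ht)]
  rw [Finset.sum_congr rfl fun i hi => Finset.sum_congr rfl (h i hi)]
  simp only [Finset.sum_ite_eq, Finset.sum_ite, Finset.sum_const_zero, add_zero, Finset.sum_const,
    nsmul_eq_mul, mul_one]
  rw [← Nat.cast_min, Finset.filter_mem_eq_inter, ← Finset.card_range (min s t)]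
  congr 2
  ext i
  simp

lemma memLp_windowBridge (n : ℕ) [NeZero n] (s m j : ℕ) :
    MemLp (windowBridge n s m j) 2 (gaussPi n) :=
  ((memLp_psum n _).sub (memLp_psum n _)).sub
    (((memLp_psum n _).sub (memLp_psum n _)).const_mul _)

lemma covariance_windowBridge_right (n : ℕ) [NeZero n] (s m j : ℕ) {X : (Fin n → ℝ) → ℝ}
    (hX : MemLp X 2 (gaussPi n)) :
    cov[X, windowBridge n s m j; gaussPi n] =
      cov[X, psum n (s + j); gaussPi n] - cov[X, psum n s; gaussPi n]
        - (j / m : ℝ) * (cov[X, psum n (s + m); gaussPi n] - cov[X, psum n s; gaussPi n]) := by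
  have hP := memLp_psum n
  change cov[X, (psum n (s + j) - psum n s) - (j / m : ℝ) • (psum n (s + m) - psum n s);
    gaussPi n] = _
  rw [covariance_sub_right hX ((hP _).sub (hP _)) (((hP _).sub (hP _)).const_smul _),
    covariance_smul_right, covariance_sub_right hX (hP _) (hP _),
    covariance_sub_right hX (hP _) (hP _)]

/-- Covariance of two window bridges in terms of the covariances `min s t` of partial sums. -/
lemma covariance_windowBridge (n : ℕ) [NeZero n] {s m j s' m' j' : ℕ}
    (hm : s + m ≤ n) (hj : j ≤ m) (hm' : s' + m' ≤ n) (hj' : j' ≤ m') :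
    cov[windowBridge n s m j, windowBridge n s' m' j'; gaussPi n] =
      let K (t : ℕ) : ℝ := min ((s + j : ℕ) : ℝ) t - min (s : ℝ) t
        - (j / m : ℝ) * (min ((s + m : ℕ) : ℝ) t - min (s : ℝ) t)
      K (s' + j') - K s' - (j' / m' : ℝ) * (K (s' + m') - K s') := by
  have h (t : ℕ) (ht : t ≤ n) : cov[windowBridge n s m j, psum n t; gaussPi n] =
      min ((s + j : ℕ) : ℝ) t - min (s : ℝ) t
        - (j / m : ℝ) * (min ((s + m : ℕ) : ℝ) t - min (s : ℝ) t) := by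
    rw [covariance_comm, covariance_windowBridge_right n s m j (memLp_psum n t),
      covariance_psum n ht (by omega), covariance_psum n ht (by omega),
      covariance_psum n ht (by omega)]
    simp only [min_comm]
  rw [covariance_windowBridge_right n _ _ _ (memLp_windowBridge n _ _ _), h _ (by omega),
    h _ (by omega), h _ (by omega)]

/-- A window bridge as a continuous linear functional. -/
noncomputable def windowBridgeCLM (n : ℕ) [NeZero n] (s m j : ℕ) : (Fin n → ℝ) →L[ℝ] ℝ :=
  let P (t : ℕ) : (Fin n → ℝ) →L[ℝ] ℝ :=
    ∑ i ∈ Finset.range t, ContinuousLinearMap.proj (Fin.ofNat n i)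
  P (s + j) - P s - (j / m : ℝ) • (P (s + m) - P s)

lemma windowBridgeCLM_apply (n : ℕ) [NeZero n] (s m j : ℕ) (x : Fin n → ℝ) :
    windowBridgeCLM n s m j x = windowBridge n s m j x := by
  simp [windowBridgeCLM, windowBridge, psum]

lemma hasGaussianLaw_windowBridge (n : ℕ) [NeZero n] (s m j : ℕ) :
    HasGaussianLaw (windowBridge n s m j) (gaussPi n) := by
  have h := (hasGaussianLaw_gaussPi n).map_fun (windowBridgeCLM n s m j)
  simpa only [windowBridgeCLM_apply] using h

lemma measurable_windowBridge (n : ℕ) [NeZero n] (s m j : ℕ) :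
    Measurable (windowBridge n s m j) := by
  unfold windowBridge psum
  fun_prop

/-- The bridge over the first `k` increments, the bridge over the remaining ones, and the value
of the full bridge at `k` are independent. -/
lemma iIndepFun_windowBridge (n : ℕ) [NeZero n] {k : ℕ} (hk : 0 < k) (hkn : k < n) :
    iIndepFun (fun (i : Fin 3) (x : Fin n → ℝ) (j : Fin (n + 1)) =>
      windowBridge n (![0, k, 0] i) (![k, n - k, n] i)
        (![min (j : ℕ) k, min (j : ℕ) (n - k), k] i) x) (gaussPi n) := by
  refine HasGaussianLaw.iIndepFun_of_covariance_eval (κ := fun _ => Fin (n + 1))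
    (X := fun i j => windowBridge n (![0, k, 0] i) (![k, n - k, n] i)
        (![min (j : ℕ) k, min (j : ℕ) (n - k), k] i)) ?_ ?_
  · have h := (hasGaussianLaw_gaussPi n).map_fun (ContinuousLinearMap.pi fun i : Fin 3 =>
      ContinuousLinearMap.pi fun j : Fin (n + 1) => windowBridgeCLM n (![0, k, 0] i)
        (![k, n - k, n] i) (![min (j : ℕ) k, min (j : ℕ) (n - k), k] i))
    convert! h using 4 with x i j
    exact (windowBridgeCLM_apply ..).symm
  · have hk' : (k : ℝ) ≠ 0 := by positivity
    have hnk : ((n - k : ℕ) : ℝ) ≠ 0 := by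
      have : n - k ≠ 0 := by omega
      exact_mod_cast this
    have h01 : ∀ j j' : ℕ, cov[windowBridge n 0 k (min j k),
        windowBridge n k (n - k) (min j' (n - k)); gaussPi n] = 0 := by
      intro j j'
      rw [covariance_windowBridge n (by omega) (by omega) (by omega) (by omega)]
      simp only [← Nat.cast_min]
      have e1 : min (0 + min j k) (k + min j' (n - k)) = min j k := by omega
      have e2 : min (0 + k) (k + min j' (n - k)) = k := by omega
      have e3 : min (0 + min j k) (k + (n - k)) = min j k := by omega
      have e4 : min (0 + k) (k + (n - k)) = k := by omega
      have e5 : min (0 + min j k) k = min j k := by omega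
      have e6 : min (0 + k) k = k := by omega
      rw [e1, e2, e3, e4, e5, e6]
      simp
    have h02 : ∀ j : ℕ, cov[windowBridge n 0 k (min j k), windowBridge n 0 n k; gaussPi n] = 0 := by
      intro j
      rw [covariance_windowBridge n (by omega) (by omega) (by omega) (by omega)]
      simp only [← Nat.cast_min]
      have e1 : min (0 + min j k) (0 + k) = min j k := by omega
      have e2 : min (0 + k) (0 + k) = k := by omega
      have e3 : min (0 + min j k) (0 + n) = min j k := by omega
      have e4 : min (0 + k) (0 + n) = k := by omega
      rw [e1, e2, e3, e4]
      simp [hk']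
    have h12 : ∀ j : ℕ, cov[windowBridge n k (n - k) (min j (n - k)), windowBridge n 0 n k;
        gaussPi n] = 0 := by
      intro j
      rw [covariance_windowBridge n (by omega) (by omega) (by omega) (by omega)]
      simp only [← Nat.cast_min]
      have e1 : min (k + min j (n - k)) (0 + k) = k := by omega
      have e2 : min (k + (n - k)) (0 + k) = k := by omega
      have e3 : min (k + min j (n - k)) (0 + n) = k + min j (n - k) := by omega
      have e4 : min (k + (n - k)) (0 + n) = k + (n - k) := by omega
      have e5 : min k (0 + k) = k := by omega
      have e6 : min k (0 + n) = k := by omega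
      rw [e1, e2, e3, e4, e5, e6]
      simp [hnk]
    intro i i' hi j j'
    fin_cases i <;> fin_cases i'
    · exact absurd rfl hi
    · exact h01 j j'
    · exact h02 j
    · exact (covariance_comm _ _).trans (h01 j' j)
    · exact absurd rfl hi
    · exact h12 j
    · exact (covariance_comm _ _).trans (h02 j')
    · exact (covariance_comm _ _).trans (h12 j')
    · exact absurd rfl hi

lemma variance_windowBridge (n : ℕ) [NeZero n] {k : ℕ} (hkn : k ≤ n) :
    Var[windowBridge n 0 n k; gaussPi n] = k * (n - k : ℕ) / n := by
  have hn : (n : ℝ) ≠ 0 := NeZero.ne _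
  rw [← covariance_self (measurable_windowBridge ..).aemeasurable,
    covariance_windowBridge n (by omega) hkn (by omega) hkn]
  have hk : (k : ℝ) ≤ n := by exact_mod_cast hkn
  simp [hk, Nat.cast_sub hkn, hn]
  field_simp

/-- The event that the bridge stays below `ε` on `{1, …, n - 1}`. -/
def stayBelow (n : ℕ) (ε : ℝ) : Set (Fin n → ℝ) :=
  {x | ∀ j ∈ Finset.Icc 1 (n - 1), bridge n x j ≤ ε}

/-- The event that the bridge stays nonpositive and is at least `-ε` at `k`. -/
def nearTouch (n k : ℕ) (ε : ℝ) : Set (Fin n → ℝ) :=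
  stayBelow n 0 ∩ {x | -ε ≤ bridge n x k}

lemma measurable_bridge (n j : ℕ) : Measurable fun x => bridge n x j := by
  unfold bridge
  fun_prop

lemma measurableSet_stayBelow (n : ℕ) (ε : ℝ) : MeasurableSet (stayBelow n ε) := by
  have h : stayBelow n ε = ⋂ j ∈ Finset.Icc 1 (n - 1), {x | bridge n x j ≤ ε} := by
    ext x
    simp [stayBelow]
  rw [h]
  exact Finset.measurableSet_biInter _ fun j _ =>
    measurableSet_le (measurable_bridge n j) measurable_const

lemma measurableSet_nearTouch (n k : ℕ) (ε : ℝ) : MeasurableSet (nearTouch n k ε) :=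
  (measurableSet_stayBelow n 0).inter (measurableSet_le measurable_const (measurable_bridge n k))

lemma gaussianReal_real_Icc_le (m : ℝ) {v : NNReal} (hv : v ≠ 0) {a b : ℝ} (hab : a ≤ b) :
    (gaussianReal m v).real (Set.Icc a b) ≤ (b - a) * (√v)⁻¹ := by
  have hpdf (x : ℝ) : gaussianPDF m v x ≤ ENNReal.ofReal (√v)⁻¹ := by
    refine ENNReal.ofReal_le_ofReal ?_
    rw [gaussianPDFReal]
    have hv' : (0 : ℝ) < v := by positivity
    have hexp : Real.exp (-(x - m) ^ 2 / (2 * v)) ≤ 1 := by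
      rw [Real.exp_le_one_iff, neg_div]
      exact neg_nonpos.2 (by positivity)
    have hsqrt : (√(2 * π * v))⁻¹ ≤ (√v)⁻¹ := by
      gcongr
      nlinarith [Real.pi_gt_three]
    calc _ ≤ (√(2 * π * v))⁻¹ * 1 := by gcongr
      _ ≤ _ := by rwa [mul_one]
  rw [measureReal_def]
  refine ENNReal.toReal_le_of_le_ofReal (by have := sub_nonneg.2 hab; positivity) ?_
  rw [gaussianReal_apply m hv]
  calc ∫⁻ x in Set.Icc a b, gaussianPDF m v x
      ≤ ∫⁻ _ in Set.Icc a b, ENNReal.ofReal (√v)⁻¹ := lintegral_mono hpdf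
    _ = ENNReal.ofReal ((b - a) * (√v)⁻¹) := by
      rw [setLIntegral_const, Real.volume_Icc, ← ENNReal.ofReal_mul (by positivity), mul_comm]

lemma windowBridge_real_Icc_le (n : ℕ) [NeZero n] {k : ℕ} (hk : 0 < k) (hkn : k < n) {ε : ℝ}
    (hε : 0 ≤ ε) :
    (gaussPi n).real (windowBridge n 0 n k ⁻¹' Set.Icc (-ε) 0)
      ≤ ε * (√(k * (n - k : ℕ) / n : ℝ))⁻¹ := by
  have hv : (0 : ℝ) < k * (n - k : ℕ) / n := by
    have : 0 < n - k := by omega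
    have : 0 < n := by omega
    positivity
  rw [← map_measureReal_apply (measurable_windowBridge ..) measurableSet_Icc,
    (hasGaussianLaw_windowBridge n 0 n k).map_eq_gaussianReal, variance_windowBridge n hkn.le]
  refine (gaussianReal_real_Icc_le _ (by simpa using hv) (by linarith)).trans_eq ?_
  rw [Real.coe_toNNReal _ hv.le]
  ring

lemma window_mem_stayBelow_iff (n : ℕ) [NeZero n] (s m : ℕ) (ε : ℝ) (x : Fin n → ℝ) :
    window n m s x ∈ stayBelow m ε ↔ ∀ j ∈ Finset.Icc 1 (m - 1), windowBridge n s m j x ≤ ε := by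
  refine forall₂_congr fun j hj => ?_
  rw [bridge_window n s (by rw [Finset.mem_Icc] at hj; omega)]

lemma nearTouch_subset (n : ℕ) [NeZero n] {k : ℕ} (hk : 0 < k) (hkn : k < n) {ε : ℝ} :
    nearTouch n k ε ⊆ window n k 0 ⁻¹' stayBelow k ε ∩ window n (n - k) k ⁻¹' stayBelow (n - k) ε
      ∩ windowBridge n 0 n k ⁻¹' Set.Icc (-ε) 0 := by
  rintro x ⟨hx, hxk⟩
  have hb (j : ℕ) (hj : 0 < j) (hjn : j < n) : windowBridge n 0 n j x ≤ 0 := by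
    rw [← bridge_eq_windowBridge n hjn.le]
    exact hx j (by rw [Finset.mem_Icc]; omega)
  rw [Set.mem_ofPred_eq, bridge_eq_windowBridge n hkn.le] at hxk
  have hk0 := hb k hk hkn
  have hn' : (n : ℝ) ≠ 0 := NeZero.ne _
  have hk' : (0 : ℝ) < k := by exact_mod_cast hk
  have hm : (0 : ℝ) < (n - k : ℕ) := by exact_mod_cast (by omega : 0 < n - k)
  have hε : 0 ≤ ε := by linarith
  refine ⟨⟨?_, ?_⟩, hxk, hk0⟩
  · refine (window_mem_stayBelow_iff ..).2 fun j hj => ?_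
    rw [Finset.mem_Icc] at hj
    have hbj := hb j (by omega) (by omega)
    have hr : (j / k : ℝ) ≤ 1 := (div_le_one hk').2 (by exact_mod_cast (by omega : j ≤ k))
    have hr0 : (0 : ℝ) ≤ j / k := by positivity
    have e : windowBridge n 0 k j x
        = windowBridge n 0 n j x + (j / k) * -windowBridge n 0 n k x := by
      simp only [windowBridge, zero_add]
      field_simp
      ring
    rw [e]
    nlinarith
  · refine (window_mem_stayBelow_iff ..).2 fun j hj => ?_
    rw [Finset.mem_Icc] at hj
    have hbj := hb (k + j) (by omega) (by omega)
    have hr : (j / (n - k : ℕ) : ℝ) ≤ 1 :=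
      (div_le_one hm).2 (by exact_mod_cast (by omega : j ≤ n - k))
    have hr0 : (0 : ℝ) ≤ j / (n - k : ℕ) := by positivity
    have e : windowBridge n k (n - k) j x = windowBridge n 0 n (k + j) x
        + (1 - j / (n - k : ℕ)) * -windowBridge n 0 n k x := by
      have hnk : (n : ℝ) = k + (n - k : ℕ) := by rw [Nat.cast_sub hkn.le]; ring
      have hnk' : k + (n - k) = n := by omega
      simp only [windowBridge, zero_add, hnk']
      rw [hnk] at hn' ⊢
      push_cast
      field_simp
      ring
    rw [e]
    nlinarith

lemma nearTouch_real_le (n : ℕ) [NeZero n] {k : ℕ} (hk : 0 < k) (hkn : k < n) {ε : ℝ}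
    (hε : 0 ≤ ε) :
    (gaussPi n).real (nearTouch n k ε) ≤ (gaussPi k).real (stayBelow k ε)
      * (gaussPi (n - k)).real (stayBelow (n - k) ε) * (ε * (√(k * (n - k : ℕ) / n : ℝ))⁻¹) := by
  have hind := iIndepFun_windowBridge n hk hkn
  set Y : Fin 3 → (Fin n → ℝ) → Fin (n + 1) → ℝ := fun i x j =>
      windowBridge n (![0, k, 0] i) (![k, n - k, n] i)
        (![min (j : ℕ) k, min (j : ℕ) (n - k), k] i) x with hY
  let B (m : ℕ) : Set (Fin (n + 1) → ℝ) :=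
    {y | ∀ j : Fin (n + 1), 1 ≤ (j : ℕ) ∧ (j : ℕ) ≤ m - 1 → y j ≤ ε}
  have hB (m : ℕ) : MeasurableSet (B m) := by
    simp only [B, Set.ofPred_forall]
    exact MeasurableSet.iInter fun j => MeasurableSet.iInter fun _ =>
      measurableSet_le (measurable_pi_apply j) measurable_const
  have hY0 : window n k 0 ⁻¹' stayBelow k ε = Y 0 ⁻¹' B k := by
    ext x
    rw [Set.mem_preimage, window_mem_stayBelow_iff]
    constructor
    · intro h j hj
      have : min (j : ℕ) k = j := by omega
      simpa [hY, this] using h j (Finset.mem_Icc.2 hj)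
    · intro h j hj
      rw [Finset.mem_Icc] at hj
      have : min j k = j := by omega
      simpa [hY, this] using h ⟨j, by omega⟩ hj
  have hY1 : window n (n - k) k ⁻¹' stayBelow (n - k) ε = Y 1 ⁻¹' B (n - k) := by
    ext x
    rw [Set.mem_preimage, window_mem_stayBelow_iff]
    constructor
    · intro h j hj
      have : min (j : ℕ) (n - k) = j := by omega
      simpa [hY, this] using h j (Finset.mem_Icc.2 hj)
    · intro h j hj
      rw [Finset.mem_Icc] at hj
      have : min j (n - k) = j := by omega
      simpa [hY, this] using h ⟨j, by omega⟩ hj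
  have hY2 : windowBridge n 0 n k ⁻¹' Set.Icc (-ε) 0
      = Y 2 ⁻¹' ((fun y => y 0) ⁻¹' Set.Icc (-ε) 0) := rfl
  have hmul := hind.measure_inter_preimage_eq_mul Finset.univ
    (sets := ![B k, B (n - k), (fun y => y 0) ⁻¹' Set.Icc (-ε) 0]) (by
      intro i _
      fin_cases i
      · exact hB k
      · exact hB (n - k)
      · exact measurable_pi_apply 0 measurableSet_Icc)
  have hsub : nearTouch n k ε ⊆ ⋂ i ∈ Finset.univ, Y i ⁻¹'
      (![B k, B (n - k), (fun y => y 0) ⁻¹' Set.Icc (-ε) 0] : Fin 3 → Set _) i := by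
    refine (nearTouch_subset n hk hkn).trans ?_
    rw [hY0, hY1, hY2]
    rintro x ⟨⟨h0, h1⟩, h2⟩
    simp only [Set.mem_iInter]
    intro i _
    fin_cases i
    · exact h0
    · exact h1
    · exact h2
  refine (measureReal_mono hsub).trans ?_
  rw [measureReal_def, hmul, Fin.prod_univ_three, ENNReal.toReal_mul, ENNReal.toReal_mul]
  have hp (m s : ℕ) (hm : m ≤ n) : (gaussPi m).real (stayBelow m ε)
      = ((gaussPi n) (window n m s ⁻¹' stayBelow m ε)).toReal := by
    rw [(measurePreserving_window n s hm).measure_preimage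
      (measurableSet_stayBelow m ε).nullMeasurableSet, measureReal_def]
  rw [hp k 0 hkn.le, hp (n - k) k (by omega), hY0, hY1]
  refine mul_le_mul_of_nonneg_left ?_ (by positivity)
  have h := windowBridge_real_Icc_le n hk hkn hε
  rwa [hY2] at h

lemma sum_range_add_of_periodic {M : Type*} [AddCommMonoid M] {g : ℕ → M} {n : ℕ}
    (hg : Function.Periodic g n) (l : ℕ) :
    ∑ j ∈ Finset.range n, g (l + j) = ∑ j ∈ Finset.range n, g j := by
  induction l with
  | zero => simp
  | succ l ih =>
    rw [← ih]
    cases n with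
    | zero => simp
    | succ m =>
      rw [Finset.sum_range_succ, Finset.sum_range_succ' (fun j => g (l + j))]
      congr 1
      · exact Finset.sum_congr rfl fun j _ => congrArg g (by ring)
      · rw [add_zero, ← hg l]
        exact congrArg g (by ring)

/-- The number of cyclic shifts of `x` that lie in `A`. -/
noncomputable def shiftCount (n : ℕ) [NeZero n] (A : Set (Fin n → ℝ)) (x : Fin n → ℝ) : ENNReal :=
  ∑ r ∈ Finset.range n, A.indicator 1 (window n n r x)

lemma measurable_shiftCount (n : ℕ) [NeZero n] {A : Set (Fin n → ℝ)} (hA : MeasurableSet A) :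
    Measurable (shiftCount n A) :=
  Finset.measurable_fun_sum _ fun r _ =>
    (measurable_one.indicator hA).comp (measurePreserving_window n r le_rfl).measurable

lemma lintegral_shiftCount (n : ℕ) [NeZero n] {A : Set (Fin n → ℝ)} (hA : MeasurableSet A) :
    ∫⁻ x, shiftCount n A x ∂gaussPi n = n * gaussPi n A := by
  unfold shiftCount
  have hm : Measurable (A.indicator (1 : (Fin n → ℝ) → ENNReal)) := measurable_one.indicator hA
  have hw (r : ℕ) := measurePreserving_window n r (le_refl n)
  rw [lintegral_finsetSum (f := fun r x => A.indicator 1 (window n n r x)) _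
    fun r _ => hm.comp (hw r).measurable]
  simp [(hw _).lintegral_comp hm, lintegral_indicator_one hA]

/-- Cyclic shifts with the bridge below `ε` are counted by those at a maximum of the bridge. -/
lemma shiftCount_stayBelow (n : ℕ) [NeZero n] (ε : ℝ) (x : Fin n → ℝ) :
    1 ≤ shiftCount n (stayBelow n 0) x ∧
      shiftCount n (stayBelow n ε) x
        ≤ 1 + ∑ k ∈ Finset.Icc 1 (n - 1), shiftCount n (nearTouch n k ε) x := by
  set S : ℕ → ℝ := fun j => psum n j x - (j / n : ℝ) * psum n n x with hS
  have hn : (n : ℝ) ≠ 0 := NeZero.ne _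
  have hn0 : 0 < n := Nat.pos_of_ne_zero (NeZero.ne n)
  have hSw (r j : ℕ) : windowBridge n r n j x = S (r + j) - S r := by
    simp only [windowBridge, hS, psum_add_period n r]
    push_cast
    ring
  have hSper : Function.Periodic S n := fun j => by
    simp only [hS, psum_add_period]
    push_cast
    field_simp
    ring
  have hwper : Function.Periodic (fun r => window n n r x) n := fun r => by
    ext i
    have : Fin.ofNat n (r + n + i) = Fin.ofNat n (r + i) :=
      Fin.ext (by simp [show r + n + i = r + i + n by ring])
    exact congrArg x this
  obtain ⟨l, hl, hlmax⟩ := Finset.exists_max_image (Finset.range n) S ⟨0, by simpa using hn0⟩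
  have hmax (j : ℕ) : S j ≤ S l := by
    rw [← hSper.map_mod_nat j]
    exact hlmax _ (Finset.mem_range.2 (Nat.mod_lt _ hn0))
  have hl0 : window n n l x ∈ stayBelow n 0 := by
    rw [window_mem_stayBelow_iff]
    intro j _
    rw [hSw]
    linarith [hmax (l + j)]
  constructor
  · refine le_trans ?_ (Finset.single_le_sum (fun _ _ => zero_le) hl)
    simp [hl0]
  · rw [shiftCount, ← sum_range_add_of_periodic
        (g := fun r => (stayBelow n ε).indicator (1 : (Fin n → ℝ) → ENNReal) (window n n r x))
        (hwper.comp ((stayBelow n ε).indicator 1)) l,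
      Finset.range_eq_Ico, Finset.sum_eq_sum_Ico_succ_bot hn0]
    have hI : Finset.Ico (0 + 1) n = Finset.Icc 1 (n - 1) := by ext; simp; omega
    rw [hI]
    refine add_le_add (Set.indicator_le_self' (fun _ _ => zero_le) _) (Finset.sum_le_sum ?_)
    intro j hj
    rw [Finset.mem_Icc] at hj
    refine le_trans ?_ (Finset.single_le_sum (fun _ _ => zero_le) hl)
    by_cases h : window n n (l + j) x ∈ stayBelow n ε
    · have h' := (window_mem_stayBelow_iff ..).1 h (n - j) (by rw [Finset.mem_Icc]; omega)
      have hln : l + j + (n - j) = l + n := by omega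
      rw [hSw, hln, hSper] at h'
      have hmem : window n n l x ∈ nearTouch n j ε := by
        refine ⟨hl0, ?_⟩
        rw [Set.mem_ofPred_eq, bridge_window n l (by omega), hSw]
        linarith
      simp [hmem, h]
    · simp [h]

lemma stayBelow_real_bounds (n : ℕ) [NeZero n] (ε : ℝ) :
    1 ≤ n * (gaussPi n).real (stayBelow n 0) ∧
      n * (gaussPi n).real (stayBelow n ε)
        ≤ 1 + n * ∑ k ∈ Finset.Icc 1 (n - 1), (gaussPi n).real (nearTouch n k ε) := by
  constructor
  · have h := lintegral_mono (μ := gaussPi n) fun x => (shiftCount_stayBelow n 0 x).1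
    rw [lintegral_shiftCount n (measurableSet_stayBelow n 0), lintegral_one, measure_univ] at h
    have := ENNReal.toReal_mono (by finiteness) h
    simpa [measureReal_def] using this
  · have h := lintegral_mono (μ := gaussPi n) fun x => (shiftCount_stayBelow n ε x).2
    rw [lintegral_shiftCount n (measurableSet_stayBelow n ε), lintegral_add_left measurable_const,
      lintegral_finsetSum _ fun k _ => measurable_shiftCount n (measurableSet_nearTouch n k ε),
      lintegral_const, measure_univ, mul_one, Finset.sum_congr rfl fun k _ =>
        lintegral_shiftCount n (measurableSet_nearTouch n k ε), ← Finset.mul_sum] at h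
    have hfin : n * ∑ k ∈ Finset.Icc 1 (n - 1), gaussPi n (nearTouch n k ε) ≠ ⊤ :=
      ENNReal.mul_ne_top (by finiteness) (ENNReal.sum_ne_top.2 fun _ _ => by finiteness)
    have := ENNReal.toReal_mono (ENNReal.add_ne_top.2 ⟨by finiteness, hfin⟩) h
    rw [ENNReal.toReal_add (by finiteness) hfin, ENNReal.toReal_mul, ENNReal.toReal_mul,
      ENNReal.toReal_sum (fun _ _ => by finiteness)] at this
    simpa [measureReal_def] using this

lemma mul_sqrt_add_le {a b : ℝ} (ha : 0 ≤ a) (hb : 0 ≤ b) :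
    (a + b) * √(a + b) ≤ 4 * (a * √a + b * √b) := by
  wlog h : b ≤ a generalizing a b
  · have := this hb ha (le_of_not_ge h)
    rw [add_comm a b]; linarith
  have h1 : √(a + b) ≤ 2 * √a := by
    rw [Real.sqrt_le_left (by positivity), mul_pow, Real.sq_sqrt ha]
    linarith
  calc (a + b) * √(a + b) ≤ (2 * a) * (2 * √a) := by gcongr; linarith
    _ = 4 * (a * √a) := by ring
    _ ≤ _ := by gcongr; nlinarith [mul_nonneg hb (Real.sqrt_nonneg b)]

lemma summable_inv_mul_sqrt_inv : Summable fun k : ℕ => (k : ℝ)⁻¹ * √((k : ℝ)⁻¹) := by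
  have h := Real.summable_nat_rpow_inv.2 (by norm_num : (1 : ℝ) < 3 / 2)
  refine h.congr fun k => ?_
  have hk : (0 : ℝ) ≤ (k : ℝ)⁻¹ := by positivity
  rw [Real.sqrt_eq_rpow, ← Real.inv_rpow (by positivity)]
  rcases hk.eq_or_lt with h0 | h0
  · rw [← h0]; norm_num
  · nth_rewrite 2 [← Real.rpow_one (k : ℝ)⁻¹]
    rw [← Real.rpow_add h0]; norm_num

lemma sum_nearTouch_weight_le (n : ℕ) :
    ∑ k ∈ Finset.Icc 1 (n - 1), (n / (k * (n - k : ℕ)) * (√(k * (n - k : ℕ) / n : ℝ))⁻¹ : ℝ)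
      ≤ 8 * ∑' k : ℕ, (k : ℝ)⁻¹ * √((k : ℝ)⁻¹) := by
  set f : ℕ → ℝ := fun k => (k : ℝ)⁻¹ * √((k : ℝ)⁻¹) with hf
  have hsum : ∑ k ∈ Finset.Icc 1 (n - 1), f k ≤ ∑' k, f k :=
    summable_inv_mul_sqrt_inv.sum_le_tsum _ fun k _ => by positivity
  have hrefl : ∑ k ∈ Finset.Icc 1 (n - 1), f (n - k) = ∑ k ∈ Finset.Icc 1 (n - 1), f k := by
    refine Finset.sum_nbij' (fun k => n - k) (fun k => n - k) ?_ ?_ ?_ ?_ fun _ _ => rfl <;>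
      · intro k hk
        simp only [Finset.mem_Icc] at hk ⊢
        omega
  calc _ ≤ ∑ k ∈ Finset.Icc 1 (n - 1), 4 * (f k + f (n - k)) := by
        refine Finset.sum_le_sum fun k hk => ?_
        rw [Finset.mem_Icc] at hk
        have hk' : (0 : ℝ) < k := by exact_mod_cast (by omega : 0 < k)
        have hm : (0 : ℝ) < (n - k : ℕ) := by exact_mod_cast (by omega : 0 < n - k)
        have hn : (n : ℝ) = k + (n - k : ℕ) := by rw [Nat.cast_sub (by omega)]; ring
        have e : (n / (k * (n - k : ℕ)) : ℝ) = (k : ℝ)⁻¹ + ((n - k : ℕ) : ℝ)⁻¹ := by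
          rw [hn]; field_simp; ring
        rw [← Real.sqrt_inv, inv_div, e]
        exact mul_sqrt_add_le (by positivity) (by positivity)
    _ = 8 * ∑ k ∈ Finset.Icc 1 (n - 1), f k := by
        rw [← Finset.mul_sum, Finset.sum_add_distrib, hrefl]; ring
    _ ≤ _ := by gcongr

lemma mul_sum_nearTouch_le (n : ℕ) [NeZero n] {ε : ℝ} (hε : 0 ≤ ε)
    (h : ∀ k, 0 < k → k < n → k * (gaussPi k).real (stayBelow k ε) ≤ 2) :
    n * ∑ k ∈ Finset.Icc 1 (n - 1), (gaussPi n).real (nearTouch n k ε)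
      ≤ 32 * (∑' k : ℕ, (k : ℝ)⁻¹ * √((k : ℝ)⁻¹)) * ε := by
  have hk : ∀ k ∈ Finset.Icc 1 (n - 1), n * (gaussPi n).real (nearTouch n k ε)
      ≤ 4 * ε * (n / (k * (n - k : ℕ)) * (√(k * (n - k : ℕ) / n : ℝ))⁻¹ : ℝ) := by
    intro k hk
    rw [Finset.mem_Icc] at hk
    have hk' : (0 : ℝ) < k := by exact_mod_cast (by omega : 0 < k)
    have hm : (0 : ℝ) < (n - k : ℕ) := by exact_mod_cast (by omega : 0 < n - k)
    have h1 : (gaussPi k).real (stayBelow k ε) ≤ 2 / k := by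
      rw [le_div_iff₀' hk']; exact h k (by omega) (by omega)
    have h2 : (gaussPi (n - k)).real (stayBelow (n - k) ε) ≤ 2 / (n - k : ℕ) := by
      rw [le_div_iff₀' hm]; exact h (n - k) (by omega) (by omega)
    calc _ ≤ n * (2 / k * (2 / (n - k : ℕ)) * (ε * (√(k * (n - k : ℕ) / n : ℝ))⁻¹)) := by
          grw [nearTouch_real_le n (by omega) (by omega) hε, h1, h2]
      _ = _ := by field_simp; ring
  rw [Finset.mul_sum]
  refine (Finset.sum_le_sum hk).trans ?_
  rw [← Finset.mul_sum]
  grw [sum_nearTouch_weight_le n]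
  exact le_of_eq (by ring)

lemma mul_stayBelow_le_two {ε : ℝ} (hε : 0 ≤ ε)
    (hε' : 32 * (∑' k : ℕ, (k : ℝ)⁻¹ * √((k : ℝ)⁻¹)) * ε ≤ 1) (n : ℕ) (hn : 0 < n) :
    n * (gaussPi n).real (stayBelow n ε) ≤ 2 := by
  induction n using Nat.strong_induction_on with
  | _ n ih =>
    have : NeZero n := ⟨hn.ne'⟩
    have h1 := (stayBelow_real_bounds n ε).2
    have h2 := mul_sum_nearTouch_le n hε fun k hk hkn => ih k hkn hk
    linarith

lemma stayBelow_zero_sub_le (n : ℕ) (ε : ℝ) :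
    (gaussPi n).real (stayBelow n 0) - (gaussPi n).real (stayBelow n (-ε))
      ≤ ∑ k ∈ Finset.Icc 1 (n - 1), (gaussPi n).real (nearTouch n k ε) := by
  have hsub : stayBelow n 0 ⊆ stayBelow n (-ε) ∪ ⋃ k ∈ Finset.Icc 1 (n - 1), nearTouch n k ε := by
    intro x hx
    by_cases h : x ∈ stayBelow n (-ε)
    · exact Or.inl h
    · simp only [stayBelow, Set.mem_ofPred_eq, not_forall, not_le] at h
      obtain ⟨k, hk, hlt⟩ := h
      exact Or.inr (Set.mem_biUnion hk ⟨hx, hlt.le⟩)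
  have h1 := (measureReal_mono (μ := gaussPi n) hsub).trans (measureReal_union_le _ _)
  have h2 := measureReal_biUnion_finset_le (μ := gaussPi n) (Finset.Icc 1 (n - 1))
    fun k => nearTouch n k ε
  linarith

lemma stayBelow_mono (n : ℕ) {a b : ℝ} (hab : a ≤ b) : stayBelow n a ⊆ stayBelow n b :=
  fun _ hx j hj => (hx j hj).trans hab

/-- There is a constant `c > 0`, independent of `n`, such that for
every `n ≥ 2` and every `|ε| ≤ 1/c`, the probabilities that the discrete Gaussian
bridge of length `n` stays below `0`, resp. below `ε`, on `{1,…,n−1}` differ by at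
most `c|ε|/n`. -/
theorem statement17 :
    ∃ c > (0 : ℝ), ∀ n : ℕ, 2 ≤ n → ∀ ε : ℝ, |ε| ≤ 1 / c →
      |((gaussPi n) {x | ∀ j ∈ Finset.Icc 1 (n - 1), bridge n x j ≤ 0}).toReal
        - ((gaussPi n) {x | ∀ j ∈ Finset.Icc 1 (n - 1), bridge n x j ≤ ε}).toReal|
      ≤ c * |ε| / n := by
  set C : ℝ := ∑' k : ℕ, (k : ℝ)⁻¹ * √((k : ℝ)⁻¹) with hC
  have hC0 : 0 ≤ C := tsum_nonneg fun k => by positivity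
  refine ⟨32 * C + 1, by positivity, fun n hn ε hε => ?_⟩
  change |(gaussPi n).real (stayBelow n 0) - (gaussPi n).real (stayBelow n ε)| ≤ _
  have : NeZero n := ⟨by omega⟩
  have hn' : (0 : ℝ) < n := by exact_mod_cast (by omega : 0 < n)
  have hsmall : 32 * C * |ε| ≤ 1 := by
    rw [le_div_iff₀' (by positivity)] at hε
    linarith [abs_nonneg ε]
  have htouch := mul_sum_nearTouch_le n (abs_nonneg ε) fun k hk _ =>
    mul_stayBelow_le_two (abs_nonneg ε) hsmall k hk
  rw [le_div_iff₀' hn']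
  rcases le_total 0 ε with h0 | h0
  · rw [abs_sub_comm, abs_of_nonneg (sub_nonneg.2 (measureReal_mono (stayBelow_mono n h0)))]
    rw [abs_of_nonneg h0] at *
    linarith [(stayBelow_real_bounds n ε).1, (stayBelow_real_bounds n ε).2]
  · rw [abs_of_nonneg (sub_nonneg.2 (measureReal_mono (stayBelow_mono n h0)))]
    have h := stayBelow_zero_sub_le n |ε|
    have he : -|ε| = ε := by rw [abs_of_nonpos h0, neg_neg]
    rw [he] at h
    have := mul_le_mul_of_nonneg_left h hn'.le
    linarith [abs_nonneg ε]
end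

section
/- Let (n_m) be a sequence of positive integers with n_m → ∞ and for each m let g_m : {1,…,n_m−1} → ℝ be thresholds with sup_{1 ≤ k ≤ n_m−1} |g_m(k)| → 0 as m → ∞. Then n_m · P( B_{n_m}(k) ≤ g_m(k) for all k ∈ {1,…,n_m−1} ) → 1 as m → ∞, i.e. P( B_{n_m}(k) ≤ g_m(k) for all k ) = n_m^{−1}(1 + o(1)). -/
open MeasureTheory ProbabilityTheory Real Filter Finset Topology

lemma sum_filter_val_lt_succ (n : ℕ) (x : Fin (n + 1) → ℝ) (j : ℕ) :
    ∑ i ∈ Finset.univ.filter (fun i : Fin (n + 1) => (i : ℕ) < j + 1), x i =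
      x 0 + ∑ i ∈ Finset.univ.filter (fun i : Fin n => (i : ℕ) < j), x i.succ := by
  rw [Finset.sum_filter, Fin.sum_univ_succ, Finset.sum_filter]
  simp

lemma bridge_zero (n : ℕ) (x : Fin n → ℝ) : bridge n x 0 = 0 := by
  simp [bridge]

lemma bridge_self {n : ℕ} (hn : n ≠ 0) (x : Fin n → ℝ) : bridge n x n = 0 := by
  have : (n : ℝ) ≠ 0 := by exact_mod_cast hn
  simp [bridge, this]

lemma bridge_comp_finRotate (n : ℕ) (x : Fin (n + 1) → ℝ) {k : ℕ} (hk : k ≤ n) :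
    bridge (n + 1) (x ∘ finRotate (n + 1)) k =
      bridge (n + 1) x (k + 1) - bridge (n + 1) x 1 := by
  have h1 : ∑ i ∈ Finset.univ.filter (fun i : Fin (n + 1) => (i : ℕ) < k),
      (x ∘ finRotate (n + 1)) i =
      ∑ i ∈ Finset.univ.filter (fun i : Fin n => (i : ℕ) < k), x i.succ := by
    rw [Finset.sum_filter, Fin.sum_univ_castSucc, Finset.sum_filter]
    simp [Nat.not_lt.2 hk]
  have h2 : ∑ i, (x ∘ finRotate (n + 1)) i = ∑ i, x i :=
    Equiv.sum_comp (finRotate (n + 1)) x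
  have h3 : ∑ i ∈ Finset.univ.filter (fun i : Fin (n + 1) => (i : ℕ) < 1), x i = x 0 := by
    simpa using sum_filter_val_lt_succ n x 0
  have h4 := sum_filter_val_lt_succ n x k
  simp only [bridge, h1, h2, h3, h4]
  push_cast
  ring

lemma measurePreserving_comp_finRotate (n : ℕ) :
    MeasurePreserving (fun x : Fin n → ℝ => x ∘ finRotate n) (gaussPi n) (gaussPi n) := by
  unfold gaussPi
  convert measurePreserving_piCongrLeft (fun _ : Fin n => gaussianReal 0 1) (finRotate n).symm
    using 1
  ext x i
  have h := MeasurableEquiv.piCongrLeft_apply_apply (β := fun _ : Fin n => ℝ)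
    (finRotate n).symm x (finRotate n i)
  rw [Equiv.symm_apply_apply] at h
  exact h.symm

/-- The paths whose value at `s` exceeds every other value of the bridge up to an error `t`. -/
def nearMaxSet (n s : ℕ) (t : ℝ) : Set (Fin n → ℝ) :=
  {x | ∀ j < n, j ≠ s → bridge n x j ≤ bridge n x s + t}

lemma measurableSet_nearMaxSet (n s : ℕ) (t : ℝ) : MeasurableSet (nearMaxSet n s t) := by
  simp only [nearMaxSet, Set.ofPred_forall]
  refine .iInter fun j => .iInter fun _ => .iInter fun _ => ?_
  exact measurableSet_le (measurable_bridge n j) ((measurable_bridge n s).add_const t)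

lemma nearMaxSet_zero_eq {n : ℕ} (t : ℝ) :
    nearMaxSet n 0 t = {x | ∀ k ∈ Finset.Icc 1 (n - 1), bridge n x k ≤ t} := by
  ext x
  simp only [nearMaxSet, Set.mem_ofPred_eq, bridge_zero, zero_add, Finset.mem_Icc]
  exact ⟨fun h k hk => h k (by lia) (by lia), fun h k hk hk' => h k (by lia)⟩

lemma preimage_nearMaxSet (n s : ℕ) (hs : s < n) (t : ℝ) :
    (fun x : Fin (n + 1) → ℝ => x ∘ finRotate (n + 1)) ⁻¹' nearMaxSet (n + 1) s t =
      nearMaxSet (n + 1) (s + 1) t := by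
  ext x
  simp only [nearMaxSet, Set.mem_preimage, Set.mem_ofPred_eq]
  rw [bridge_comp_finRotate n x hs.le]
  constructor
  · intro h j hj hjs
    rcases j with _ | j
    · have := h n (by lia) (by lia)
      rw [bridge_comp_finRotate n x le_rfl, bridge_self (by lia)] at this
      rw [bridge_zero]
      linarith
    · have := h j (by lia) (by lia)
      rw [bridge_comp_finRotate n x (by lia)] at this
      linarith
  · intro h j hj hjs
    rw [bridge_comp_finRotate n x (by lia)]
    rcases Nat.lt_succ_iff_lt_or_eq.1 hj with hj | rfl
    · linarith [h (j + 1) (by lia) (by lia)]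
    · have := h 0 (by lia) (by lia)
      rw [bridge_zero] at this
      rw [bridge_self (by lia)]
      linarith

lemma measure_nearMaxSet (n s : ℕ) (hs : s < n) (t : ℝ) :
    gaussPi n (nearMaxSet n s t) = gaussPi n (nearMaxSet n 0 t) := by
  obtain _ | n := n
  · lia
  induction s with
  | zero => rfl
  | succ s ih =>
    rw [← ih (by lia), ← preimage_nearMaxSet n s (by lia) t]
    exact (measurePreserving_comp_finRotate (n + 1)).measure_preimage
      (measurableSet_nearMaxSet _ _ _).nullMeasurableSet

lemma one_le_mul_measure_nearMaxSet {n : ℕ} (hn : n ≠ 0) :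
    1 ≤ n * gaussPi n (nearMaxSet n 0 0) := by
  have hU : (⋃ s ∈ Finset.range n, nearMaxSet n s 0) = Set.univ := by
    refine Set.eq_univ_of_forall fun x => ?_
    obtain ⟨s, hs, hmax⟩ := Finset.exists_max_image (Finset.range n) (bridge n x)
      ⟨0, Finset.mem_range.2 (by lia)⟩
    refine Set.mem_biUnion (show s ∈ Finset.range n from hs) fun j hj _ => ?_
    simpa using hmax j (Finset.mem_range.2 hj)
  calc (1 : ENNReal) = gaussPi n (⋃ s ∈ Finset.range n, nearMaxSet n s 0) := by rw [hU, measure_univ]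
    _ ≤ ∑ s ∈ Finset.range n, gaussPi n (nearMaxSet n s 0) := measure_biUnion_finset_le _ _
    _ = ∑ s ∈ Finset.range n, gaussPi n (nearMaxSet n 0 0) :=
      Finset.sum_congr rfl fun s hs => measure_nearMaxSet n s (Finset.mem_range.1 hs) 0
    _ = _ := by simp

lemma mul_measure_nearMaxSet_le_one (n : ℕ) {t : ℝ} (ht : t < 0) :
    n * gaussPi n (nearMaxSet n 0 t) ≤ 1 := by
  calc n * gaussPi n (nearMaxSet n 0 t)
      = ∑ s ∈ Finset.range n, gaussPi n (nearMaxSet n 0 t) := by simp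
    _ = ∑ s ∈ Finset.range n, gaussPi n (nearMaxSet n s t) :=
      Finset.sum_congr rfl fun s hs => (measure_nearMaxSet n s (Finset.mem_range.1 hs) t).symm
    _ = gaussPi n (⋃ s ∈ Finset.range n, nearMaxSet n s t) := by
      refine (measure_biUnion_finset ?_ fun s _ => measurableSet_nearMaxSet n s t).symm
      intro s hs s' hs' hne
      refine Set.disjoint_left.2 fun x hx hx' => ?_
      have h1 := hx s' (Finset.mem_range.1 hs') hne.symm
      have h2 := hx' s (Finset.mem_range.1 hs) hne
      linarith
    _ ≤ 1 := prob_le_one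

lemma lintegral_gaussPi_succ (n : ℕ) {f : (Fin (n + 1) → ℝ) → ENNReal} (hf : Measurable f) :
    ∫⁻ x, f x ∂gaussPi (n + 1) =
      ∫⁻ a, ∫⁻ y, f (Fin.cons a y) ∂gaussPi n ∂gaussianReal 0 1 := by
  have h := (measurePreserving_piFinSuccAbove (fun _ : Fin (n + 1) => gaussianReal 0 1) 0).symm
  rw [gaussPi, ← h.lintegral_comp hf, lintegral_prod]
  · simp [MeasurableEquiv.piFinSuccAbove_symm_apply, Fin.insertNthEquiv, gaussPi]
  · exact (hf.comp h.measurable).aemeasurable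

lemma measurable_finCons_uncurry (n : ℕ) :
    Measurable fun p : ℝ × (Fin n → ℝ) => (Fin.cons p.1 p.2 : Fin (n + 1) → ℝ) := by
  refine measurable_pi_lambda _ fun i => ?_
  refine Fin.cases ?_ (fun i => ?_) i
  · simpa using measurable_fst
  · simp only [Fin.cons_succ]; fun_prop

/-- One-dimensional Cameron–Martin formula. -/
lemma lintegral_gaussianReal_add {f : ℝ → ENNReal} (hf : Measurable f) (t : ℝ) :
    ∫⁻ a, f (a + t) ∂gaussianReal 0 1 =
      ∫⁻ a, ENNReal.ofReal (Real.exp (t * a - t ^ 2 / 2)) * f a ∂gaussianReal 0 1 := by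
  have hm : Measurable fun a : ℝ => f (a + t) := by fun_prop
  have hm' : Measurable fun a : ℝ => ENNReal.ofReal (Real.exp (t * a - t ^ 2 / 2)) * f a := by
    fun_prop
  rw [gaussianReal_of_var_ne_zero _ one_ne_zero,
    lintegral_withDensity_eq_lintegral_mul _ (measurable_gaussianPDF 0 1) hm,
    lintegral_withDensity_eq_lintegral_mul _ (measurable_gaussianPDF 0 1) hm',
    ← lintegral_sub_right_eq_self _ t]
  refine lintegral_congr fun a => ?_
  simp only [Pi.mul_apply, sub_add_cancel, gaussianPDF_def]
  rw [← mul_assoc, ← ENNReal.ofReal_mul (gaussianPDFReal_nonneg _ _ _)]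
  congr 2
  simp only [gaussianPDFReal, sub_zero, NNReal.coe_one, mul_one]
  rw [mul_assoc, ← Real.exp_add]
  congr 2
  ring

lemma bridge_cons_cons_one (n : ℕ) (a b : ℝ) (y : Fin n → ℝ) :
    bridge (n + 2) (Fin.cons a (Fin.cons b y)) 1 =
      a - (a + b + ∑ i, y i) / (n + 2) := by
  have h : ∑ i ∈ Finset.univ.filter (fun i : Fin (n + 2) => (i : ℕ) < 1),
      (Fin.cons a (Fin.cons b y) : Fin (n + 2) → ℝ) i = a := by
    simpa using sum_filter_val_lt_succ (n + 1) (Fin.cons a (Fin.cons b y)) 0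
  simp only [bridge, h, Fin.sum_univ_succ, Fin.cons_zero, Fin.cons_succ]
  push_cast
  ring

lemma bridge_cons_cons_add_two (n : ℕ) (a b : ℝ) (y : Fin n → ℝ) (k : ℕ) :
    bridge (n + 2) (Fin.cons a (Fin.cons b y)) (k + 2) =
      a + b + ∑ i ∈ Finset.univ.filter (fun i : Fin n => (i : ℕ) < k), y i
        - (k + 2) * ((a + b + ∑ i, y i) / (n + 2)) := by
  simp only [bridge, sum_filter_val_lt_succ, Fin.sum_univ_succ, Fin.cons_zero, Fin.cons_succ]
  push_cast
  ring

lemma cons_cons_add_mem_nearMaxSet (n : ℕ) (a b t δ : ℝ) (y : Fin n → ℝ) :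
    (Fin.cons (a + δ) (Fin.cons (b - δ) y) : Fin (n + 2) → ℝ) ∈ nearMaxSet (n + 2) 1 t ↔
      (Fin.cons a (Fin.cons b y) : Fin (n + 2) → ℝ) ∈ nearMaxSet (n + 2) 1 (t + δ) := by
  have hab : a + δ + (b - δ) = a + b := by ring
  refine forall_congr' fun j => forall_congr' fun _ => forall_congr' fun hj => ?_
  rcases j with _ | _ | j
  · rw [bridge_zero, bridge_zero, bridge_cons_cons_one, bridge_cons_cons_one, hab]
    constructor <;> intro h <;> linarith
  · exact absurd rfl hj
  · rw [bridge_cons_cons_add_two, bridge_cons_cons_add_two, bridge_cons_cons_one,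
      bridge_cons_cons_one, hab]
    constructor <;> intro h <;> linarith

/-- The probability that the bridge is nearly maximal at `1`, given the first two increments. -/
noncomputable def nearMaxProb (n : ℕ) (t : ℝ) (p : ℝ × ℝ) : ENNReal :=
  ∫⁻ y, (nearMaxSet (n + 2) 1 t).indicator 1 (Fin.cons p.1 (Fin.cons p.2 y)) ∂gaussPi n

lemma measurable_nearMaxProb (n : ℕ) (t : ℝ) : Measurable (nearMaxProb n t) := by
  refine Measurable.lintegral_prod_right' (f := fun q : (ℝ × ℝ) × (Fin n → ℝ) =>
    (nearMaxSet (n + 2) 1 t).indicator (1 : (Fin (n + 2) → ℝ) → ENNReal)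
      (Fin.cons q.1.1 (Fin.cons q.1.2 q.2))) ?_
  refine (measurable_one.indicator (measurableSet_nearMaxSet _ _ _)).comp ?_
  exact (measurable_finCons_uncurry (n + 1)).comp
    ((measurable_fst.comp measurable_fst).prodMk
      ((measurable_finCons_uncurry n).comp
        ((measurable_snd.comp measurable_fst).prodMk measurable_snd)))

lemma measure_nearMaxSet_eq_lintegral (n : ℕ) (t : ℝ) :
    gaussPi (n + 2) (nearMaxSet (n + 2) 0 t) =
      ∫⁻ a, ∫⁻ b, nearMaxProb n t (a, b) ∂gaussianReal 0 1 ∂gaussianReal 0 1 := by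
  have hm : Measurable ((nearMaxSet (n + 2) 1 t).indicator (1 : (Fin (n + 2) → ℝ) → ENNReal)) :=
    measurable_one.indicator (measurableSet_nearMaxSet _ _ _)
  rw [← measure_nearMaxSet (n + 2) 1 (by lia), ← lintegral_indicator_one
    (measurableSet_nearMaxSet _ _ _), lintegral_gaussPi_succ _ hm]
  refine lintegral_congr fun a => ?_
  exact lintegral_gaussPi_succ _ (hm.comp
    ((measurable_finCons_uncurry (n + 1)).comp (measurable_const.prodMk measurable_id)))

lemma measure_nearMaxSet_add (n : ℕ) (t δ : ℝ) :
    gaussPi (n + 2) (nearMaxSet (n + 2) 0 (t + δ)) =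
      ∫⁻ a, ∫⁻ b, ENNReal.ofReal (Real.exp (δ * (a - b) - δ ^ 2)) * nearMaxProb n t (a, b)
        ∂gaussianReal 0 1 ∂gaussianReal 0 1 := by
  have hI := measurable_nearMaxProb n t
  have hshift : ∀ a b : ℝ, nearMaxProb n (t + δ) (a, b) = nearMaxProb n t (a + δ, b + -δ) := by
    intro a b
    refine lintegral_congr fun y => ?_
    rw [← sub_eq_add_neg]
    by_cases h : (Fin.cons a (Fin.cons b y) : Fin (n + 2) → ℝ) ∈ nearMaxSet (n + 2) 1 (t + δ)
    · rw [Set.indicator_of_mem h, Set.indicator_of_mem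
        ((cons_cons_add_mem_nearMaxSet n a b t δ y).2 h)]
      rfl
    · rw [Set.indicator_of_notMem h, Set.indicator_of_notMem
        (mt (cons_cons_add_mem_nearMaxSet n a b t δ y).1 h)]
  have hb : ∀ a : ℝ, ∫⁻ b, nearMaxProb n t (a, b + -δ) ∂gaussianReal 0 1 =
      ∫⁻ b, ENNReal.ofReal (Real.exp (-δ * b - (-δ) ^ 2 / 2)) * nearMaxProb n t (a, b)
        ∂gaussianReal 0 1 := fun a =>
    lintegral_gaussianReal_add (f := fun b => nearMaxProb n t (a, b)) (by fun_prop) (-δ)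
  simp only [measure_nearMaxSet_eq_lintegral, hshift, hb]
  rw [lintegral_gaussianReal_add (f := fun a => ∫⁻ b, ENNReal.ofReal
    (Real.exp (-δ * b - (-δ) ^ 2 / 2)) * nearMaxProb n t (a, b) ∂gaussianReal 0 1)]
  · refine lintegral_congr fun a => ?_
    rw [← lintegral_const_mul _ (by fun_prop)]
    refine lintegral_congr fun b => ?_
    rw [← mul_assoc, ← ENNReal.ofReal_mul (Real.exp_pos _).le, ← Real.exp_add]
    ring_nf
  · refine Measurable.lintegral_prod_right' (f := fun p : ℝ × ℝ => ENNReal.ofReal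
      (Real.exp (-δ * p.2 - (-δ) ^ 2 / 2)) * nearMaxProb n t p) ?_
    fun_prop

lemma measure_nearMaxSet_le (n : ℕ) (t : ℝ) {δ : ℝ} (hδ : 0 ≤ δ) :
    gaussPi (n + 2) (nearMaxSet (n + 2) 0 t) ≤
      ENNReal.ofReal (Real.exp (δ ^ 2)) * gaussPi (n + 2) (nearMaxSet (n + 2) 0 (t - δ)) +
      ENNReal.ofReal (δ * Real.exp 1) * gaussPi (n + 2) (nearMaxSet (n + 2) 0 (t + 1)) := by
  have hI := measurable_nearMaxProb n t
  have hmeas : ∀ c δ : ℝ, Measurable fun p : ℝ × ℝ => ENNReal.ofReal c *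
      (ENNReal.ofReal (Real.exp (δ * (p.1 - p.2) - δ ^ 2)) * nearMaxProb n t p) :=
    fun c δ => by fun_prop
  have hmul : ∀ c δ : ℝ, ENNReal.ofReal c * gaussPi (n + 2) (nearMaxSet (n + 2) 0 (t + δ)) =
      ∫⁻ p : ℝ × ℝ, ENNReal.ofReal c * (ENNReal.ofReal (Real.exp (δ * (p.1 - p.2) - δ ^ 2)) *
        nearMaxProb n t p) ∂(gaussianReal 0 1).prod (gaussianReal 0 1) := by
    intro c δ
    rw [measure_nearMaxSet_add, lintegral_const_mul _ (by fun_prop),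
      lintegral_prod _ (by fun_prop)]
  rw [sub_eq_add_neg, hmul, hmul, ← lintegral_add_left (hmeas _ _),
    measure_nearMaxSet_eq_lintegral, ← lintegral_prod _ hI.aemeasurable]
  refine lintegral_mono fun p => ?_
  rw [← mul_assoc, ← mul_assoc, ← add_mul, ← ENNReal.ofReal_mul (by positivity),
    ← ENNReal.ofReal_mul (by positivity), ← ENNReal.ofReal_add (by positivity) (by positivity)]
  refine le_mul_of_one_le_left' (ENNReal.one_le_ofReal.2 ?_)
  rw [mul_assoc, ← Real.exp_add, ← Real.exp_add]
  have e1 : δ ^ 2 + (-δ * (p.1 - p.2) - (-δ) ^ 2) = -δ * (p.1 - p.2) := by ring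
  have e2 : 1 + (1 * (p.1 - p.2) - 1 ^ 2) = p.1 - p.2 := by ring
  rw [e1, e2]
  have h1 := Real.add_one_le_exp (-δ * (p.1 - p.2))
  have h2 := mul_le_mul_of_nonneg_left
    ((lt_add_one (p.1 - p.2)).le.trans (Real.add_one_le_exp (p.1 - p.2))) hδ
  linarith

lemma measure_le_abs_sum_le {n : ℕ} (hn : n ≠ 0) :
    gaussPi n {y | (n : ℝ) ≤ |∑ i, y i|} ≤ ENNReal.ofReal (1 / n) := by
  have hn' : (0 : ℝ) < n := by positivity
  have hL : ∀ i : Fin n, MemLp (fun y : Fin n → ℝ => y i) 2 (gaussPi n) := fun i =>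
    (memLp_id_gaussianReal 2).comp_measurePreserving
      (measurePreserving_eval (fun _ : Fin n => gaussianReal 0 1) i)
  have hmean : ∫ y, ∑ i, y i ∂gaussPi n = 0 := by
    rw [integral_finsetSum _ fun i _ => (hL i).integrable one_le_two]
    refine Finset.sum_eq_zero fun i _ => ?_
    have h := integral_comp_eval (μ := fun _ : Fin n => gaussianReal 0 1) (i := i) (f := id)
      aestronglyMeasurable_id
    simpa [gaussPi] using h
  have hvar : Var[fun y => ∑ i, y i; gaussPi n] = n := by
    have := variance_sum_pi (μ := fun _ : Fin n => gaussianReal 0 1) (X := fun _ => id)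
      fun _ => memLp_id_gaussianReal 2
    simp only [id_eq, variance_id_gaussianReal] at this
    rw [gaussPi]
    convert this using 1
    · congr 1
      ext y
      simp
    · simp
  have h := meas_ge_le_variance_div_sq (μ := gaussPi n) (X := fun y => ∑ i, y i)
    (memLp_finsetSum _ fun i _ => hL i) hn'
  rw [hmean, hvar] at h
  simp only [sub_zero] at h
  refine h.trans (ENNReal.ofReal_le_ofReal (le_of_eq ?_))
  field_simp

lemma cons_cons_mem_nearMaxSet {n : ℕ} (hn : n ≠ 0) {a b : ℝ} (ha : a ∈ Set.Icc (7 : ℝ) 8)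
    (hb : b ∈ Set.Icc (-8 : ℝ) (-7))
    {y : Fin n → ℝ} (hy : ∀ k ∈ Finset.Icc 1 (n - 1), bridge n y k ≤ 2)
    (hT : |∑ i, y i| < n) :
    (Fin.cons a (Fin.cons b y) : Fin (n + 2) → ℝ) ∈ nearMaxSet (n + 2) 1 (-1) := by
  obtain ⟨ha1, ha2⟩ := ha
  obtain ⟨hb1, hb2⟩ := hb
  obtain ⟨hT1, hT2⟩ := abs_lt.1 hT
  have hn' : (0 : ℝ) < n := by positivity
  set T := ∑ i, y i with hTdef
  obtain ⟨μ, hμ⟩ : ∃ μ, μ = (a + b + T) / (n + 2) := ⟨_, rfl⟩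
  have hμT : (n + 2) * μ = a + b + T := by rw [hμ]; field_simp
  have hμ1 : -1 ≤ μ := by nlinarith
  have hμ2 : μ ≤ 1 := by nlinarith
  intro j hj hj1
  rw [bridge_cons_cons_one, ← hTdef, ← hμ]
  rcases j with _ | _ | k
  · rw [bridge_zero]; linarith
  · exact absurd rfl hj1
  · rw [bridge_cons_cons_add_two, ← hTdef, ← hμ]
    have hk : k < n := by lia
    have hB : bridge n y k ≤ 2 := by
      rcases Nat.eq_zero_or_pos k with rfl | hk0
      · rw [bridge_zero]; norm_num
      · exact hy k (Finset.mem_Icc.2 ⟨hk0, by lia⟩)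
    rw [bridge, ← hTdef] at hB
    have hr0 : 0 ≤ (k : ℝ) / n := by positivity
    have hr1 : (k : ℝ) / n ≤ 1 := by
      rw [div_le_one hn']; exact_mod_cast hk.le
    have hkr : (k : ℝ) / n * T = k * μ + (k : ℝ) / n * (2 * μ - (a + b)) := by
      have : T = n * μ + (2 * μ - (a + b)) := by linarith
      rw [this]; field_simp
    have : (k : ℝ) / n * (2 * μ - (a + b)) ≤ 3 := by nlinarith
    linarith

lemma measure_Icc_gaussianReal_pos {u v : ℝ} (h : u < v) : 0 < gaussianReal 0 1 (Set.Icc u v) := by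
  refine pos_iff_ne_zero.2 fun h0 => ?_
  have := gaussianReal_absolutelyContinuous' 0 one_ne_zero h0
  simp [h.not_ge] at this

lemma exists_mul_measure_bridge_le :
    ∃ C : ℝ, 0 ≤ C ∧ ∀ n : ℕ, n ≠ 0 → n * (gaussPi n).real (nearMaxSet n 0 2) ≤ C := by
  set γ := gaussianReal 0 1
  set q := γ.real (Set.Icc 7 8) * γ.real (Set.Icc (-8) (-7)) with hq
  have hqpos : 0 < q := mul_pos
    (ENNReal.toReal_pos (measure_Icc_gaussianReal_pos (by norm_num)).ne' (measure_ne_top _ _))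
    (ENNReal.toReal_pos (measure_Icc_gaussianReal_pos (by norm_num)).ne' (measure_ne_top _ _))
  refine ⟨1 / q + 1, by positivity, fun n hn => ?_⟩
  have hn' : (0 : ℝ) < n := by positivity
  set G : Set (Fin n → ℝ) := nearMaxSet n 0 2 \ {y | (n : ℝ) ≤ |∑ i, y i|} with hG
  have hGm : MeasurableSet G := (measurableSet_nearMaxSet _ _ _).diff
    (measurableSet_le (by fun_prop) (by fun_prop))
  have hlow : γ (Set.Icc 7 8) * (γ (Set.Icc (-8) (-7)) * gaussPi n G) ≤
      gaussPi (n + 2) (nearMaxSet (n + 2) 0 (-1)) := by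
    rw [measure_nearMaxSet_eq_lintegral, mul_comm, ← lintegral_indicator_const measurableSet_Icc]
    refine lintegral_mono fun a => ?_
    by_cases ha : a ∈ Set.Icc (7 : ℝ) 8
    swap
    · simp [Set.indicator_of_notMem ha]
    rw [Set.indicator_of_mem ha, mul_comm, ← lintegral_indicator_const measurableSet_Icc]
    refine lintegral_mono fun b => ?_
    by_cases hb : b ∈ Set.Icc (-8 : ℝ) (-7)
    swap
    · simp [Set.indicator_of_notMem hb]
    rw [Set.indicator_of_mem hb, ← lintegral_indicator_one hGm]
    refine lintegral_mono fun y => ?_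
    by_cases hy : y ∈ G
    swap
    · simp [Set.indicator_of_notMem hy]
    obtain ⟨hy1, hy2⟩ := hy
    rw [nearMaxSet_zero_eq] at hy1
    rw [Set.indicator_of_mem (cons_cons_mem_nearMaxSet hn ha hb hy1 (not_le.1 hy2))]
    exact Set.indicator_le_self _ _ _
  have h1 : q * (gaussPi n).real G ≤ (gaussPi (n + 2)).real (nearMaxSet (n + 2) 0 (-1)) := by
    have := ENNReal.toReal_mono (measure_ne_top _ _) hlow
    simpa only [hq, Measure.real, ENNReal.toReal_mul, ← mul_assoc] using this
  have h2 : (n + 2) * (gaussPi (n + 2)).real (nearMaxSet (n + 2) 0 (-1)) ≤ 1 := by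
    have := ENNReal.toReal_mono ENNReal.one_ne_top
      (mul_measure_nearMaxSet_le_one (n + 2) (t := -1) (by norm_num))
    rw [ENNReal.toReal_mul, ENNReal.toReal_natCast, ENNReal.toReal_one] at this
    exact_mod_cast this
  have h3 : (gaussPi n).real {y | (n : ℝ) ≤ |∑ i, y i|} ≤ 1 / n :=
    ENNReal.toReal_le_of_le_ofReal (by positivity) (measure_le_abs_sum_le hn)
  have h4 : (gaussPi n).real (nearMaxSet n 0 2) ≤
      (gaussPi n).real G + (gaussPi n).real {y | (n : ℝ) ≤ |∑ i, y i|} :=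
    (measureReal_mono (by rw [hG, Set.sdiff_union_self]; exact Set.subset_union_left)).trans
      (measureReal_union_le _ _)
  have h5 : n * (gaussPi n).real G ≤ 1 / q := by
    rw [le_div_iff₀ hqpos]
    have : 0 ≤ (gaussPi (n + 2)).real (nearMaxSet (n + 2) 0 (-1)) := measureReal_nonneg
    nlinarith
  have h6 : n * (gaussPi n).real {y | (n : ℝ) ≤ |∑ i, y i|} ≤ 1 := by
    calc _ ≤ (n : ℝ) * (1 / n) := by gcongr
      _ = 1 := by field_simp
  nlinarith

lemma nearMaxSet_mono (n s : ℕ) {t t' : ℝ} (h : t ≤ t') : nearMaxSet n s t ⊆ nearMaxSet n s t' :=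
  fun _ hx j hj hjs => (hx j hj hjs).trans (by gcongr)

lemma measureReal_nearMaxSet_le {n : ℕ} (hn : 2 ≤ n) {t δ : ℝ} (hδ : 0 ≤ δ) (ht : t ≤ 1) :
    (gaussPi n).real (nearMaxSet n 0 t) ≤
      Real.exp (δ ^ 2) * (gaussPi n).real (nearMaxSet n 0 (t - δ)) +
      δ * Real.exp 1 * (gaussPi n).real (nearMaxSet n 0 2) := by
  obtain ⟨n, rfl⟩ := Nat.exists_eq_add_of_le' hn
  have h := ENNReal.toReal_mono (by finiteness) (measure_nearMaxSet_le n t hδ)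
  rw [ENNReal.toReal_add (by finiteness) (by finiteness), ENNReal.toReal_mul, ENNReal.toReal_mul,
    ENNReal.toReal_ofReal (by positivity), ENNReal.toReal_ofReal (by positivity)] at h
  refine h.trans (add_le_add le_rfl (mul_le_mul_of_nonneg_left ?_ (by positivity)))
  exact measureReal_mono (nearMaxSet_mono _ _ (by linarith))

/-- If `n_m → ∞` and the thresholds `g_m` satisfy
`sup_{1 ≤ k ≤ n_m−1} |g_m(k)| → 0`, then
`P(B_{n_m}(k) ≤ g_m(k) ∀ k ∈ {1,…,n_m−1}) = n_m^{−1}(1+o(1))`. -/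
theorem statement18
    (n : ℕ → ℕ) (hn : Tendsto n atTop atTop)
    (g : ℕ → ℕ → ℝ)
    (hg : ∀ ε > (0 : ℝ), ∀ᶠ m in atTop, ∀ k ∈ Finset.Icc 1 (n m - 1), |g m k| ≤ ε) :
    Tendsto
      (fun m => (n m : ℝ) *
        ((gaussPi (n m)) {x | ∀ k ∈ Finset.Icc 1 (n m - 1),
            bridge (n m) x k ≤ g m k}).toReal)
      atTop (𝓝 1) := by
  obtain ⟨C, hC0, hC⟩ := exists_mul_measure_bridge_le
  have hlow : ∀ ε : ℝ, 0 < ε → ε ≤ 1 → ∀ᶠ m in atTop,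
      Real.exp (-ε ^ 2) * (1 - ε * Real.exp 1 * C) ≤ (n m : ℝ) *
        ((gaussPi (n m)) {x | ∀ k ∈ Finset.Icc 1 (n m - 1), bridge (n m) x k ≤ g m k}).toReal := by
    intro ε hε hε1
    filter_upwards [hg ε hε, hn.eventually_ge_atTop 2] with m hgm hnm
    have hsub : nearMaxSet (n m) 0 (0 - ε) ⊆
        {x | ∀ k ∈ Finset.Icc 1 (n m - 1), bridge (n m) x k ≤ g m k} := by
      rw [nearMaxSet_zero_eq]
      intro x hx k hk
      linarith [hx k hk, (abs_le.1 (hgm k hk)).1]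
    have hmono := measureReal_mono (μ := gaussPi (n m)) hsub
    have h1 : 1 ≤ n m * (gaussPi (n m)).real (nearMaxSet (n m) 0 0) := by
      have := ENNReal.toReal_mono (by finiteness)
        (one_le_mul_measure_nearMaxSet (n := n m) (by lia))
      simpa [Measure.real] using this
    have h2 := measureReal_nearMaxSet_le hnm hε.le zero_le_one
    have h3 := hC (n m) (by lia)
    have hn0 : (0 : ℝ) ≤ n m := by positivity
    refine le_trans ?_ (mul_le_mul_of_nonneg_left hmono hn0)
    rw [Real.exp_neg, inv_mul_le_iff₀ (Real.exp_pos _)]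
    have h4 := mul_le_mul_of_nonneg_left h2 hn0
    have h5 := mul_le_mul_of_nonneg_left h3 (show 0 ≤ ε * Real.exp 1 by positivity)
    linarith
  have hupp : ∀ ε : ℝ, 0 < ε → ε ≤ 1 → ∀ᶠ m in atTop, (n m : ℝ) *
        ((gaussPi (n m)) {x | ∀ k ∈ Finset.Icc 1 (n m - 1), bridge (n m) x k ≤ g m k}).toReal ≤
      Real.exp ((2 * ε) ^ 2) + 2 * ε * Real.exp 1 * C := by
    intro ε hε hε1
    filter_upwards [hg ε hε, hn.eventually_ge_atTop 2] with m hgm hnm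
    have hsub : {x | ∀ k ∈ Finset.Icc 1 (n m - 1), bridge (n m) x k ≤ g m k} ⊆
        nearMaxSet (n m) 0 ε := by
      rw [nearMaxSet_zero_eq]
      intro x hx k hk
      linarith [hx k hk, (abs_le.1 (hgm k hk)).2]
    have hmono := measureReal_mono (μ := gaussPi (n m)) hsub
    have h1 : n m * (gaussPi (n m)).real (nearMaxSet (n m) 0 (ε - 2 * ε)) ≤ 1 := by
      have := ENNReal.toReal_mono ENNReal.one_ne_top
        (mul_measure_nearMaxSet_le_one (n m) (t := ε - 2 * ε) (by linarith))
      simpa [Measure.real] using this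
    have h2 := measureReal_nearMaxSet_le hnm (δ := 2 * ε) (by positivity) hε1
    have h3 := hC (n m) (by lia)
    have hn0 : (0 : ℝ) ≤ n m := by positivity
    refine (mul_le_mul_of_nonneg_left (hmono.trans h2) hn0).trans ?_
    have h4 := mul_le_mul_of_nonneg_left h1 (Real.exp_pos ((2 * ε) ^ 2)).le
    have h5 := mul_le_mul_of_nonneg_left h3 (show 0 ≤ 2 * ε * Real.exp 1 by positivity)
    linarith
  have hlim1 : Tendsto (fun ε : ℝ => Real.exp (-ε ^ 2) * (1 - ε * Real.exp 1 * C)) (𝓝[>] 0)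
      (𝓝 1) := by
    refine tendsto_nhdsWithin_of_tendsto_nhds (Continuous.tendsto' (by fun_prop) _ _ ?_)
    simp
  have hlim2 : Tendsto (fun ε : ℝ => Real.exp ((2 * ε) ^ 2) + 2 * ε * Real.exp 1 * C) (𝓝[>] 0)
      (𝓝 1) := by
    refine tendsto_nhdsWithin_of_tendsto_nhds (Continuous.tendsto' (by fun_prop) _ _ ?_)
    simp
  have hε1 : ∀ᶠ ε : ℝ in 𝓝[>] 0, 0 < ε ∧ ε ≤ 1 := by
    filter_upwards [Ioc_mem_nhdsGT (zero_lt_one' ℝ)] with ε hε using hε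
  refine tendsto_order.2 ⟨fun c hc => ?_, fun c hc => ?_⟩
  · obtain ⟨ε, hε, h0, h1⟩ := ((hlim1.eventually_const_lt hc).and hε1).exists
    exact (hlow ε h0 h1).mono fun m hm => hε.trans_le hm
  · obtain ⟨ε, hε, h0, h1⟩ := ((hlim2.eventually_lt_const hc).and hε1).exists
    exact (hupp ε h0 h1).mono fun m hm => hm.trans_lt hε
end
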